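/- Let S be a Lalley–Gatzouras carpet. Then the Assouad dimension of S equals β_x + β_y. -/

import Mathlib

open Set Metric Filter

/-- The Assouad dimension of a set `E` in a metric space: the infimum of all `α ≥ 0`
for which there is `C > 0` such that for every `x ∈ E` and all radii `0 < r ≤ R`,
the set `E ∩ B(x, R)` can be covered by at most `C · (R / r) ^ α` balls of radius `r`. -/
noncomputable def assouadDim {X : Type*} [PseudoMetricSpace X] (E : Set X) : ℝ :=
  sInf { α : ℝ | 0 ≤ α ∧ ∃ C : ℝ, 0 < C ∧ ∀ x ∈ E, ∀ r R : ℝ, 0 < r → r ≤ R →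
    ∃ F : Finset X, (F.card : ℝ) ≤ C * (R / r) ^ α ∧
      E ∩ Metric.ball x R ⊆ ⋃ y ∈ F, Metric.ball y r }

/-- The defining data of a Lalley–Gatzouras carpet: `m ≥ 2` rows, the `i`-th row
(for `0 ≤ i < m`) containing `n i ≥ 1` affine maps `A_{ij}(x,y) = (a i j • x + c i j, b i • y + d i)`
(for `0 ≤ j < n i`), with at least one row containing at least two maps, each map contracting
strictly more horizontally than vertically, the rows stacked disjointly in order inside `[0,1]`
vertically, and the maps of each row placed disjointly in order inside `[0,1]` horizontally. -/
structure LGData where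
  m : ℕ
  n : ℕ → ℕ
  a : ℕ → ℕ → ℝ
  b : ℕ → ℝ
  c : ℕ → ℕ → ℝ
  d : ℕ → ℝ
  hm : 2 ≤ m
  hn_one : ∀ i, i < m → 1 ≤ n i
  hn_two : ∃ i, i < m ∧ 2 ≤ n i
  ha_pos : ∀ i, i < m → ∀ j, j < n i → 0 < a i j
  ha_lt_b : ∀ i, i < m → ∀ j, j < n i → a i j < b i
  hb_lt_one : ∀ i, i < m → b i < 1
  hd_nonneg : 0 ≤ d 0
  hd_gap : ∀ i, i + 1 < m → d i + b i ≤ d (i + 1)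
  hd_top : d (m - 1) + b (m - 1) ≤ 1
  hc_nonneg : ∀ i, i < m → 0 ≤ c i 0
  hc_gap : ∀ i, i < m → ∀ j, j + 1 < n i → c i j + a i j ≤ c i (j + 1)
  hc_top : ∀ i, i < m → c i (n i - 1) + a i (n i - 1) ≤ 1

/-- The affine map `A_{ij}(x, y) = (a_{ij} x + c_{ij}, b_i y + d_i)`. -/
def lgMap (D : LGData) (ij : ℕ × ℕ) (p : ℝ × ℝ) : ℝ × ℝ :=
  (D.a ij.1 ij.2 * p.1 + D.c ij.1 ij.2, D.b ij.1 * p.2 + D.d ij.1)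

/-- The composition `A_{ω_1} ∘ ⋯ ∘ A_{ω_k}` along a word `ω`. -/
def lgWordMap (D : LGData) : List (ℕ × ℕ) → ℝ × ℝ → ℝ × ℝ
  | [] => id
  | ij :: w => lgMap D ij ∘ lgWordMap D w

/-- The plane `ℝ²` with the Euclidean metric, identifying a pair with a Euclidean point. -/
noncomputable def toE (p : ℝ × ℝ) : EuclideanSpace ℝ (Fin 2) :=
  (WithLp.equiv 2 (Fin 2 → ℝ)).symm ![p.1, p.2]

/-- The Lalley–Gatzouras carpet: the limit set
`S = ⋂_{k ≥ 1} ⋃_{ω ∈ 𝒥^k} (A_{ω_1} ∘ ⋯ ∘ A_{ω_k})([0,1]²)`, as a subset of the Euclidean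
plane. -/
def lgCarpet (D : LGData) : Set (EuclideanSpace ℝ (Fin 2)) :=
  ⋂ k ∈ {k : ℕ | 1 ≤ k},
    ⋃ w ∈ {w : List (ℕ × ℕ) | w.length = k ∧ ∀ ij ∈ w, ij.1 < D.m ∧ ij.2 < D.n ij.1},
      (fun p : ℝ × ℝ => toE (lgWordMap D w p)) '' (Set.Icc (0 : ℝ) 1 ×ˢ Set.Icc (0 : ℝ) 1)

/-! ### Superadditivity of clamped lengths -/

/-- The length of the part of the interval `[x, x + u]` lying in `[c - ρ, c + ρ]`. -/
def clampLen (c ρ x u : ℝ) : ℝ :=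
  max (c - ρ) (min (c + ρ) (x + u)) - max (c - ρ) (min (c + ρ) x)

theorem clampLen_nonneg (c ρ x : ℝ) {u : ℝ} (hu : 0 ≤ u) : 0 ≤ clampLen c ρ x u := by
  unfold clampLen
  have : x ≤ x + u := by linarith
  have := max_le_max_left (c - ρ) (min_le_min_left (c + ρ) this)
  linarith

theorem clampLen_le (c x u : ℝ) {ρ : ℝ} (hρ : 0 ≤ ρ) : clampLen c ρ x u ≤ 2 * ρ := by
  unfold clampLen
  have h1 : max (c - ρ) (min (c + ρ) (x + u)) ≤ c + ρ :=
    max_le (by linarith) (min_le_left _ _)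
  have h2 : c - ρ ≤ max (c - ρ) (min (c + ρ) x) := le_max_left _ _
  linarith

theorem clampLen_eq {c ρ x u : ℝ} (hu : 0 ≤ u) (h1 : c - ρ ≤ x) (h2 : x + u ≤ c + ρ) :
    clampLen c ρ x u = u := by
  unfold clampLen
  rw [min_eq_right h2, min_eq_right (by linarith), max_eq_right (by linarith), max_eq_right h1]
  ring

/-- If an interval of length at most `R` contains a point within `R` of `c`, then it lies in
`[c - 2R, c + 2R]`. -/
theorem clampLen_eq_of_mem {c R x u s : ℝ} (hu : 0 ≤ u) (huR : u ≤ R) (hs : s ∈ Icc (0 : ℝ) 1)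
    (h : |x + u * s - c| ≤ R) : clampLen c (2 * R) x u = u := by
  have hbd := abs_le.1 h
  have h1 : 0 ≤ u * s := mul_nonneg hu hs.1
  have h2 : u * s ≤ u := mul_le_of_le_one_right hu hs.2
  exact clampLen_eq hu (by linarith [hbd.1]) (by linarith [hbd.2])

/-- The increments of a monotone function over ordered subintervals of `[0, 1]` add up to at most
its increment over `[0, 1]`. -/
theorem sum_increment_le {φ : ℝ → ℝ} (hφ : Monotone φ) {n : ℕ} (hn : 1 ≤ n) {s l : ℕ → ℝ}
    (h0 : 0 ≤ s 0) (hgap : ∀ j, j + 1 < n → s j + l j ≤ s (j + 1))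
    (htop : s (n - 1) + l (n - 1) ≤ 1) :
    ∑ j ∈ Finset.range n, (φ (s j + l j) - φ (s j)) ≤ φ 1 - φ 0 := by
  have key : ∀ k, k < n →
      ∑ j ∈ Finset.range (k + 1), (φ (s j + l j) - φ (s j)) ≤ φ (s k + l k) - φ (s 0) := by
    intro k
    induction k with
    | zero => intro _; simp
    | succ k ih =>
      intro hk
      rw [Finset.sum_range_succ]
      have := ih (by omega)
      have := hφ (hgap k hk)
      linarith
  have := key (n - 1) (by omega)
  rw [Nat.sub_add_cancel hn] at this
  have := hφ htop
  have := hφ h0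
  linarith

theorem sum_clampLen_le (c ρ x : ℝ) {u : ℝ} (hu : 0 ≤ u) {n : ℕ} (hn : 1 ≤ n) {s l : ℕ → ℝ}
    (h0 : 0 ≤ s 0) (hgap : ∀ j, j + 1 < n → s j + l j ≤ s (j + 1))
    (htop : s (n - 1) + l (n - 1) ≤ 1) :
    ∑ j ∈ Finset.range n, clampLen c ρ (x + u * s j) (u * l j) ≤ clampLen c ρ x u := by
  have hφ : Monotone fun z : ℝ => max (c - ρ) (min (c + ρ) (x + u * z)) := by
    intro y z hyz
    have : x + u * y ≤ x + u * z := by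
      have := mul_le_mul_of_nonneg_left hyz hu
      linarith
    exact max_le_max_left _ (min_le_min_left _ this)
  have := sum_increment_le hφ hn h0 hgap htop
  simp only [mul_one, mul_zero, add_zero] at this
  refine le_trans (le_of_eq ?_) this
  refine Finset.sum_congr rfl fun j _ => ?_
  unfold clampLen
  rw [show x + u * s j + u * l j = x + u * (s j + l j) by ring]

/-- Ordered subintervals of `[0, 1]` really lie in `[0, 1]`. -/
theorem ordered_intervals_mem {n : ℕ} {s l : ℕ → ℝ} (hl : ∀ j, j < n → 0 ≤ l j)
    (h0 : 0 ≤ s 0) (hgap : ∀ j, j + 1 < n → s j + l j ≤ s (j + 1))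
    (htop : s (n - 1) + l (n - 1) ≤ 1) {j : ℕ} (hj : j < n) : 0 ≤ s j ∧ s j + l j ≤ 1 := by
  constructor
  · induction j with
    | zero => exact h0
    | succ k ih =>
      have := ih (by omega)
      have := hgap k hj
      have := hl k (by omega)
      linarith
  · have key : ∀ k, j ≤ k → k < n → s j + l j ≤ s k + l k := by
      intro k hjk
      induction k, hjk using Nat.le_induction with
      | base => intro _; exact le_rfl
      | succ k _ ih =>
        intro hk
        have := ih (by omega)
        have := hgap k hk
        have := hl (k + 1) hk
        linarith
    exact (key (n - 1) (by omega) (by omega)).trans htop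

theorem exists_pos_le_of_finset {ι : Type*} (s : Finset ι) (f : ι → ℝ) (hf : ∀ i ∈ s, 0 < f i) :
    ∃ κ : ℝ, 0 < κ ∧ ∀ i ∈ s, κ ≤ f i := by
  classical
  induction s using Finset.induction_on with
  | empty => exact ⟨1, one_pos, by simp⟩
  | insert i s _ ih =>
    obtain ⟨κ, hκ, h⟩ := ih fun j hj => hf j (Finset.mem_insert_of_mem hj)
    refine ⟨min κ (f i), lt_min hκ (hf i (Finset.mem_insert_self _ _)), fun j hj => ?_⟩
    rcases Finset.mem_insert.1 hj with rfl | hj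
    · exact min_le_right _ _
    · exact (min_le_left _ _).trans (h j hj)

/-! ### Coverings by squares -/

/-- `E` is covered by at most `N` closed squares of half side `r`. -/
def SquareCover (E : Set (ℝ × ℝ)) (r N : ℝ) : Prop :=
  ∃ F : Finset (ℝ × ℝ), (F.card : ℝ) ≤ N ∧
    ∀ p ∈ E, ∃ q ∈ F, |p.1 - q.1| ≤ r ∧ |p.2 - q.2| ≤ r

theorem SquareCover.mono {E E' : Set (ℝ × ℝ)} {r N N' : ℝ} (h : SquareCover E r N)
    (hE : E' ⊆ E) (hN : N ≤ N') : SquareCover E' r N' := by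
  obtain ⟨F, hF, hc⟩ := h
  exact ⟨F, hF.trans hN, fun p hp => hc p (hE hp)⟩

theorem squareCover_empty {r N : ℝ} (hN : 0 ≤ N) : SquareCover ∅ r N :=
  ⟨∅, by simpa using hN, by simp⟩

theorem squareCover_of_subset_biUnion {ι : Type*} (s : Finset ι) {E : Set (ℝ × ℝ)}
    {G : ι → Set (ℝ × ℝ)} {r : ℝ} {N : ι → ℝ} (hE : ∀ p ∈ E, ∃ i ∈ s, p ∈ G i)
    (h : ∀ i ∈ s, SquareCover (G i) r (N i)) : SquareCover E r (∑ i ∈ s, N i) := by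
  classical
  choose! F hF hc using h
  refine ⟨s.biUnion F, ?_, fun p hp => ?_⟩
  · calc ((s.biUnion F).card : ℝ) ≤ ((∑ i ∈ s, (F i).card : ℕ) : ℝ) := by
          exact_mod_cast Finset.card_biUnion_le
      _ = ∑ i ∈ s, ((F i).card : ℝ) := by push_cast; rfl
      _ ≤ _ := Finset.sum_le_sum hF
  · obtain ⟨i, hi, hpi⟩ := hE p hp
    obtain ⟨q, hq, hpq⟩ := hc i hi p hpi
    exact ⟨q, Finset.mem_biUnion.2 ⟨i, hi, hq⟩, hpq⟩

namespace LGData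

variable (D : LGData)

/-! ### Basic properties of the data -/

theorem b_pos {i : ℕ} (hi : i < D.m) : 0 < D.b i :=
  (D.ha_pos i hi 0 (D.hn_one i hi)).trans (D.ha_lt_b i hi 0 (D.hn_one i hi))

theorem row_mem {i : ℕ} (hi : i < D.m) : 0 ≤ D.d i ∧ D.d i + D.b i ≤ 1 :=
  ordered_intervals_mem (fun _ hj => (D.b_pos hj).le) D.hd_nonneg D.hd_gap D.hd_top hi

theorem column_mem {i j : ℕ} (hi : i < D.m) (hj : j < D.n i) :
    0 ≤ D.c i j ∧ D.c i j + D.a i j ≤ 1 :=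
  ordered_intervals_mem (fun j hj => (D.ha_pos i hi j hj).le) (D.hc_nonneg i hi) (D.hc_gap i hi)
    (D.hc_top i hi) hj

theorem sum_clampLen_row_le (c ρ y : ℝ) {t : ℝ} (ht : 0 ≤ t) :
    ∑ i ∈ Finset.range D.m, clampLen c ρ (y + t * D.d i) (t * D.b i) ≤ clampLen c ρ y t :=
  sum_clampLen_le c ρ y ht (by have := D.hm; omega) D.hd_nonneg D.hd_gap D.hd_top

theorem sum_clampLen_column_le (c ρ x : ℝ) {u : ℝ} (hu : 0 ≤ u) {i : ℕ} (hi : i < D.m) :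
    ∑ j ∈ Finset.range (D.n i), clampLen c ρ (x + u * D.c i j) (u * D.a i j) ≤
      clampLen c ρ x u :=
  sum_clampLen_le c ρ x hu (D.hn_one i hi) (D.hc_nonneg i hi) (D.hc_gap i hi) (D.hc_top i hi)

theorem sum_a_le_one {i : ℕ} (hi : i < D.m) : ∑ j ∈ Finset.range (D.n i), D.a i j ≤ 1 := by
  simpa using sum_increment_le monotone_id (D.hn_one i hi) (D.hc_nonneg i hi) (D.hc_gap i hi)
    (D.hc_top i hi)

/-- Uniform bounds for the contraction ratios. -/
structure Bounds (κ ρ : ℝ) : Prop where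
  κ_pos : 0 < κ
  κ_le : ∀ i, i < D.m → ∀ j, j < D.n i → κ ≤ D.a i j
  ρ_pos : 0 < ρ
  ρ_lt : ρ < 1
  le_ρ : ∀ i, i < D.m → D.b i ≤ ρ

theorem exists_bounds : ∃ κ ρ : ℝ, D.Bounds κ ρ := by
  obtain ⟨κ, hκ, h⟩ := exists_pos_le_of_finset
    ((Finset.range D.m).sigma fun i => Finset.range (D.n i)) (fun p => D.a p.1 p.2) (by
      rintro ⟨i, j⟩ hp
      simp only [Finset.mem_sigma, Finset.mem_range] at hp
      exact D.ha_pos i hp.1 j hp.2)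
  obtain ⟨ε, hε, h'⟩ := exists_pos_le_of_finset (Finset.range D.m) (fun i => 1 - D.b i) (by
      intro i hi
      have := D.hb_lt_one i (Finset.mem_range.1 hi)
      linarith)
  have h0 : 0 < D.m := by have := D.hm; omega
  refine ⟨κ, 1 - ε, hκ, fun i hi j hj => h ⟨i, j⟩ (by simp [hi, hj]), ?_, by linarith,
    fun i hi => ?_⟩
  · have := h' 0 (Finset.mem_range.2 h0)
    have := D.b_pos h0
    linarith
  · have := h' i (Finset.mem_range.2 hi)
    linarith

variable {D} {κ ρ : ℝ}

theorem Bounds.κ_le_b (h : D.Bounds κ ρ) {i : ℕ} (hi : i < D.m) : κ ≤ D.b i :=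
  (h.κ_le i hi 0 (D.hn_one i hi)).trans (D.ha_lt_b i hi 0 (D.hn_one i hi)).le

theorem Bounds.a_le_ρ (h : D.Bounds κ ρ) {i j : ℕ} (hi : i < D.m) (hj : j < D.n i) :
    D.a i j ≤ ρ :=
  (D.ha_lt_b i hi j hj).le.trans (h.le_ρ i hi)

theorem Bounds.κ_le_one (h : D.Bounds κ ρ) : κ ≤ 1 := by
  have h0 : 0 < D.m := by have := D.hm; omega
  exact (h.κ_le_b h0).trans (D.hb_lt_one 0 h0).le

theorem sum_a_rpow_le_one {βx : ℝ} (hβx : βx ∈ Ioc (0 : ℝ) 1)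
    (hmax : ∀ α ∈ Set.Ioc (0 : ℝ) 1,
      (∃ i, i < D.m ∧ ∑ j ∈ Finset.range (D.n i), D.a i j ^ α = 1) → α ≤ βx)
    {i : ℕ} (hi : i < D.m) : ∑ j ∈ Finset.range (D.n i), D.a i j ^ βx ≤ 1 := by
  by_contra! hlt
  have hcont : ContinuousOn (fun s : ℝ => ∑ j ∈ Finset.range (D.n i), D.a i j ^ s)
      (Icc βx 1) := by
    refine continuousOn_finsetSum _ fun j hj => ?_
    exact (Real.continuous_const_rpow
      (D.ha_pos i hi j (Finset.mem_range.1 hj)).ne').continuousOn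
  have hmem : (1 : ℝ) ∈ Icc (∑ j ∈ Finset.range (D.n i), D.a i j ^ (1 : ℝ))
      (∑ j ∈ Finset.range (D.n i), D.a i j ^ βx) :=
    ⟨by simpa using D.sum_a_le_one hi, hlt.le⟩
  obtain ⟨s, hs, hs1⟩ := intermediate_value_Icc' hβx.2 hcont hmem
  have hle := hmax s ⟨hβx.1.trans_le hs.1, hs.2⟩ ⟨i, hi, hs1⟩
  have : s = βx := le_antisymm hle hs.1
  subst this
  exact hlt.ne hs1.symm

/-! ### The limit set in coordinates -/

variable (D)

/-- The union of the cylinder rectangles of level `k`. -/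
def level : ℕ → Set (ℝ × ℝ)
  | 0 => Icc (0 : ℝ) 1 ×ˢ Icc (0 : ℝ) 1
  | k + 1 => {p | ∃ i, i < D.m ∧ ∃ j, j < D.n i ∧ ∃ q ∈ level k, lgMap D (i, j) q = p}

/-- The carpet as a subset of `ℝ × ℝ`. -/
def limitSet : Set (ℝ × ℝ) := {p | ∀ k, p ∈ D.level k}

theorem lgMap_mem_unit {i j : ℕ} (hi : i < D.m) (hj : j < D.n i) {q : ℝ × ℝ}
    (hq : q ∈ Icc (0 : ℝ) 1 ×ˢ Icc (0 : ℝ) 1) :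
    lgMap D (i, j) q ∈ Icc (0 : ℝ) 1 ×ˢ Icc (0 : ℝ) 1 := by
  obtain ⟨⟨h1, h2⟩, h3, h4⟩ := hq
  have hr := D.row_mem hi
  have hc := D.column_mem hi hj
  have hb := (D.b_pos hi).le
  have ha := (D.ha_pos i hi j hj).le
  have := mul_nonneg ha h1
  have := mul_le_of_le_one_right ha h2
  have := mul_nonneg hb h3
  have := mul_le_of_le_one_right hb h4
  refine ⟨⟨?_, ?_⟩, ?_, ?_⟩ <;> simp only [lgMap] <;> linarith

theorem level_succ_subset (k : ℕ) : D.level (k + 1) ⊆ D.level k := by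
  induction k with
  | zero =>
    rintro p ⟨i, hi, j, hj, q, hq, rfl⟩
    exact D.lgMap_mem_unit hi hj hq
  | succ k ih =>
    rintro p ⟨i, hi, j, hj, q, hq, rfl⟩
    exact ⟨i, hi, j, hj, q, ih hq, rfl⟩

theorem level_antitone : Antitone D.level := antitone_nat_of_succ_le D.level_succ_subset

theorem mem_level_iff (k : ℕ) (p : ℝ × ℝ) :
    p ∈ D.level k ↔ ∃ w : List (ℕ × ℕ), (w.length = k ∧ ∀ ij ∈ w, ij.1 < D.m ∧ ij.2 < D.n ij.1) ∧
      ∃ q ∈ Icc (0 : ℝ) 1 ×ˢ Icc (0 : ℝ) 1, lgWordMap D w q = p := by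
  induction k generalizing p with
  | zero =>
    constructor
    · intro hp
      exact ⟨[], by simp, p, hp, rfl⟩
    · rintro ⟨w, ⟨hw, -⟩, q, hq, rfl⟩
      rw [List.length_eq_zero_iff] at hw
      subst hw
      exact hq
  | succ k ih =>
    constructor
    · rintro ⟨i, hi, j, hj, q, hq, rfl⟩
      obtain ⟨w, ⟨hw, hv⟩, q', hq', rfl⟩ := (ih q).1 hq
      refine ⟨(i, j) :: w, ⟨by simp [hw], ?_⟩, q', hq', rfl⟩
      intro ij hij
      rcases List.mem_cons.1 hij with rfl | h
      · exact ⟨hi, hj⟩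
      · exact hv ij h
    · rintro ⟨w, ⟨hw, hv⟩, q, hq, rfl⟩
      cases w with
      | nil => simp at hw
      | cons ij w =>
        have h0 := hv ij (by simp)
        refine ⟨ij.1, h0.1, ij.2, h0.2, lgWordMap D w q, (ih _).2 ?_, rfl⟩
        exact ⟨w, ⟨by simpa using hw, fun x hx => hv x (by simp [hx])⟩, q, hq, rfl⟩

theorem mem_lgCarpet_iff (x : EuclideanSpace ℝ (Fin 2)) :
    x ∈ lgCarpet D ↔ (x 0, x 1) ∈ D.limitSet := by
  have htoE : ∀ p : ℝ × ℝ, toE p = x ↔ p = (x 0, x 1) := by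
    intro p
    constructor
    · rintro rfl
      simp [toE]
    · rintro rfl
      ext i
      fin_cases i <;> simp [toE]
  have key : x ∈ lgCarpet D ↔ ∀ k, 1 ≤ k → (x 0, x 1) ∈ D.level k := by
    simp only [lgCarpet, mem_iInter, mem_iUnion, mem_ofPred_eq, mem_image, mem_level_iff, htoE,
      exists_prop]
  rw [key]
  constructor
  · intro h k
    rcases Nat.eq_zero_or_pos k with rfl | hk
    · exact D.level_succ_subset 0 (h 1 le_rfl)
    · exact h k hk
  · intro h k _
    exact h k

theorem limitSet_subset_unit : D.limitSet ⊆ Icc (0 : ℝ) 1 ×ˢ Icc (0 : ℝ) 1 := fun _ hp => hp 0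

theorem lgMap_mem_limitSet {i j : ℕ} (hi : i < D.m) (hj : j < D.n i) {q : ℝ × ℝ}
    (hq : q ∈ D.limitSet) : lgMap D (i, j) q ∈ D.limitSet := by
  intro k
  exact D.level_succ_subset k ⟨i, hi, j, hj, q, hq k, rfl⟩

theorem exists_preimage_of_mem_limitSet {p : ℝ × ℝ} (hp : p ∈ D.limitSet) :
    ∃ i, i < D.m ∧ ∃ j, j < D.n i ∧ ∃ q ∈ D.limitSet, lgMap D (i, j) q = p := by
  by_contra! hcon
  let inv : ℕ → ℕ → ℝ × ℝ := fun i j =>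
    ((p.1 - D.c i j) / D.a i j, (p.2 - D.d i) / D.b i)
  have hinv : ∀ i, i < D.m → ∀ j, j < D.n i → ∀ q, lgMap D (i, j) q = p → q = inv i j := by
    rintro i hi j hj q rfl
    have := (D.b_pos hi).ne'
    have := (D.ha_pos i hi j hj).ne'
    ext <;> simp [inv, lgMap] <;> field_simp
  have hinv' : ∀ i, i < D.m → ∀ j, j < D.n i → lgMap D (i, j) (inv i j) = p := by
    intro i hi j hj
    have := (D.b_pos hi).ne'
    have := (D.ha_pos i hi j hj).ne'
    ext <;> simp only [inv, lgMap] <;> field_simp <;> ring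
  have hex : ∀ i j, ∃ k, i < D.m → j < D.n i → inv i j ∉ D.level k := by
    intro i j
    by_cases hij : i < D.m ∧ j < D.n i
    · by_contra! hall
      exact hcon i hij.1 j hij.2 (inv i j) (fun k => (hall k).2.2) (hinv' i hij.1 j hij.2)
    · exact ⟨0, fun hi hj => absurd ⟨hi, hj⟩ hij⟩
  choose K hK using hex
  let M := ((Finset.range D.m).sigma fun i => Finset.range (D.n i)).sup fun ij => K ij.1 ij.2
  obtain ⟨i, hi, j, hj, q, hq, hqp⟩ := hp (M + 1)
  rw [hinv i hi j hj q hqp] at hq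
  refine hK i j hi hj (D.level_antitone ?_ hq)
  exact Finset.le_sup (f := fun ij : (_ : ℕ) × ℕ => K ij.1 ij.2) (b := ⟨i, j⟩) (by simp [hi, hj])

theorem limitSet_nonempty : D.limitSet.Nonempty := by
  have hi : 0 < D.m := by have := D.hm; omega
  have hj : 0 < D.n 0 := D.hn_one 0 hi
  have hb := D.b_pos hi
  have hb1 := D.hb_lt_one 0 hi
  have ha := D.ha_pos 0 hi 0 hj
  have hab := D.ha_lt_b 0 hi 0 hj
  have hr := D.row_mem hi
  have hc := D.column_mem hi hj
  let p : ℝ × ℝ := (D.c 0 0 / (1 - D.a 0 0), D.d 0 / (1 - D.b 0))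
  have h1 : 0 < 1 - D.a 0 0 := by linarith
  have h2 : 0 < 1 - D.b 0 := by linarith
  have hfix : lgMap D (0, 0) p = p := by
    ext <;> simp only [p, lgMap] <;> field_simp <;> ring
  refine ⟨p, fun k => ?_⟩
  induction k with
  | zero =>
    refine ⟨⟨div_nonneg hc.1 h1.le, (div_le_one h1).2 ?_⟩,
      div_nonneg hr.1 h2.le, (div_le_one h2).2 ?_⟩ <;> linarith
  | succ k ih => exact ⟨0, hi, 0, hj, p, ih, hfix⟩

/-! ### Strips of the limit set -/

/-- The part of the limit set lying in the rows prescribed by the word `V`. -/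
def strip : List ℕ → Set (ℝ × ℝ)
  | [] => D.limitSet
  | i :: V => {p | ∃ j, j < D.n i ∧ ∃ q ∈ strip V, lgMap D (i, j) q = p}

/-- The height of the strip `V`. -/
def height : List ℕ → ℝ
  | [] => 1
  | i :: V => D.b i * height V

/-- The lower end of the strip `V`. -/
def base : List ℕ → ℝ
  | [] => 0
  | i :: V => D.d i + D.b i * base V

/-- All letters of `V` are row indices. -/
def IsRowWord (V : List ℕ) : Prop := ∀ i ∈ V, i < D.m

variable {D}

theorem IsRowWord.nil : D.IsRowWord [] := by simp [IsRowWord]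

theorem isRowWord_cons {i : ℕ} {V : List ℕ} :
    D.IsRowWord (i :: V) ↔ i < D.m ∧ D.IsRowWord V := by
  simp [IsRowWord]

theorem IsRowWord.append {i : ℕ} {V : List ℕ} (hV : D.IsRowWord V) (hi : i < D.m) :
    D.IsRowWord (V ++ [i]) := by
  intro k hk
  rcases List.mem_append.1 hk with h | h
  · exact hV k h
  · rw [List.mem_singleton.1 h]; exact hi

theorem isRowWord_replicate {i : ℕ} (hi : i < D.m) (L : ℕ) :
    D.IsRowWord (List.replicate L i) := by
  intro k hk
  rw [List.eq_of_mem_replicate hk]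
  exact hi

theorem height_pos {V : List ℕ} (hV : D.IsRowWord V) : 0 < D.height V := by
  induction V with
  | nil => exact one_pos
  | cons i V ih =>
    rw [isRowWord_cons] at hV
    exact mul_pos (D.b_pos hV.1) (ih hV.2)

theorem height_append (V : List ℕ) (i : ℕ) : D.height (V ++ [i]) = D.height V * D.b i := by
  induction V with
  | nil => simp [height]
  | cons k V ih => simp only [List.cons_append, height, ih]; ring

theorem height_replicate (L i : ℕ) : D.height (List.replicate L i) = D.b i ^ L := by
  induction L with
  | zero => rfl
  | succ L ih => rw [List.replicate_succ, height, ih]; ring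

theorem base_append (V : List ℕ) (i : ℕ) :
    D.base (V ++ [i]) = D.base V + D.height V * D.d i := by
  induction V with
  | nil => simp [height, base]
  | cons k V ih => simp only [List.cons_append, height, base, ih]; ring

theorem strip_subset_limitSet {V : List ℕ} (hV : D.IsRowWord V) : D.strip V ⊆ D.limitSet := by
  induction V with
  | nil => exact subset_rfl
  | cons i V ih =>
    rw [isRowWord_cons] at hV
    rintro p ⟨j, hj, q, hq, rfl⟩
    exact D.lgMap_mem_limitSet hV.1 hj (ih hV.2 hq)

theorem exists_mem_strip_append {V : List ℕ} {p : ℝ × ℝ} (hp : p ∈ D.strip V) :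
    ∃ i, i < D.m ∧ p ∈ D.strip (V ++ [i]) := by
  induction V generalizing p with
  | nil =>
    obtain ⟨i, hi, j, hj, q, hq, hqp⟩ := D.exists_preimage_of_mem_limitSet hp
    exact ⟨i, hi, j, hj, q, hq, hqp⟩
  | cons k V ih =>
    obtain ⟨j, hj, q, hq, hqp⟩ := hp
    obtain ⟨i, hi, hqi⟩ := ih hq
    exact ⟨i, hi, j, hj, q, hqi, hqp⟩

theorem strip_append_subset (V : List ℕ) {i : ℕ} (hi : i < D.m) :
    D.strip (V ++ [i]) ⊆ D.strip V := by
  induction V with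
  | nil =>
    rintro p ⟨j, hj, q, hq, rfl⟩
    exact D.lgMap_mem_limitSet hi hj hq
  | cons k V ih =>
    rintro p ⟨j, hj, q, hq, rfl⟩
    exact ⟨j, hj, q, ih hq, rfl⟩

theorem strip_nonempty {V : List ℕ} (hV : D.IsRowWord V) : (D.strip V).Nonempty := by
  induction V with
  | nil => exact D.limitSet_nonempty
  | cons i V ih =>
    rw [isRowWord_cons] at hV
    obtain ⟨q, hq⟩ := ih hV.2
    exact ⟨_, 0, D.hn_one i hV.1, q, hq, rfl⟩

theorem strip_fst_mem {V : List ℕ} (hV : D.IsRowWord V) {p : ℝ × ℝ} (hp : p ∈ D.strip V) :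
    p.1 ∈ Icc (0 : ℝ) 1 :=
  (D.limitSet_subset_unit (strip_subset_limitSet hV hp)).1

theorem exists_strip_snd_eq {V : List ℕ} {p : ℝ × ℝ} (hp : p ∈ D.strip V) :
    ∃ s ∈ Icc (0 : ℝ) 1, p.2 = D.base V + D.height V * s := by
  induction V generalizing p with
  | nil => exact ⟨p.2, (D.limitSet_subset_unit hp).2, by simp [base, height]⟩
  | cons i V ih =>
    obtain ⟨j, hj, q, hq, rfl⟩ := hp
    obtain ⟨s, hs, hq2⟩ := ih hq
    refine ⟨s, hs, ?_⟩
    simp only [lgMap, base, height, hq2]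
    ring

/-! ### Affine copies of strips -/

/-- The map `(v, w) ↦ (x + u v, y + t w)`. -/
def affineBox (x y u t : ℝ) (q : ℝ × ℝ) : ℝ × ℝ := (x + u * q.1, y + t * q.2)

theorem affineBox_lgMap (x y u t : ℝ) (i j : ℕ) (q : ℝ × ℝ) :
    affineBox x y u t (lgMap D (i, j) q) =
      affineBox (x + u * D.c i j) (y + t * D.d i) (u * D.a i j) (t * D.b i) q := by
  ext <;> simp only [affineBox, lgMap] <;> ring

theorem one_le_inv_rpow_mul {κ β h r : ℝ} (hκ : 0 < κ) (hβ : 0 ≤ β) (hr : 0 < r)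
    (h1 : κ * r ≤ h) : 1 ≤ κ⁻¹ ^ β * (h / r) ^ β := by
  have hh : 0 ≤ h := (mul_nonneg hκ.le hr.le).trans h1
  rw [← Real.mul_rpow (inv_nonneg.2 hκ.le) (div_nonneg hh hr.le)]
  refine Real.one_le_rpow ?_ hβ
  rw [← mul_div_assoc, le_div_iff₀ hr, inv_mul_eq_div, le_div_iff₀ hκ]
  linarith

theorem mul_div_rpow {h b r β : ℝ} (hh : 0 ≤ h) (hb : 0 ≤ b) (hr : 0 < r) :
    (h * b / r) ^ β = (h / r) ^ β * b ^ β := by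
  rw [mul_div_right_comm, Real.mul_rpow (div_nonneg hh hr.le) hb]

theorem squareCover_strip_one {r x y u t : ℝ} (hu : 0 ≤ u) (hur : u ≤ r) (ht : 0 ≤ t)
    {V : List ℕ} (hV : D.IsRowWord V) (hle : t * D.height V ≤ r) :
    SquareCover (affineBox x y u t '' D.strip V) r 1 := by
  refine ⟨{(x, y + t * D.base V)}, by simp, ?_⟩
  rintro _ ⟨p, hp, rfl⟩
  refine ⟨_, Finset.mem_singleton_self _, ?_, ?_⟩
  · have h1 := strip_fst_mem hV hp
    simp only [affineBox, add_sub_cancel_left]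
    rw [abs_of_nonneg (mul_nonneg hu h1.1)]
    exact (mul_le_of_le_one_right hu h1.2).trans hur
  · obtain ⟨s, hs, h2⟩ := exists_strip_snd_eq hp
    have hth := mul_nonneg ht (height_pos hV).le
    simp only [affineBox, h2]
    rw [show y + t * (D.base V + D.height V * s) - (y + t * D.base V) =
      t * D.height V * s by ring, abs_of_nonneg (mul_nonneg hth hs.1)]
    exact (mul_le_of_le_one_right hth hs.2).trans hle

/-- A copy of a strip of width at most `r` is covered according to the vertical dimension. -/
theorem squareCover_strip_of_width_le (hB : D.Bounds κ ρ) {βy r : ℝ} (hβ : 0 ≤ βy) (hr : 0 < r)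
    (hβy : ∑ i ∈ Finset.range D.m, D.b i ^ βy = 1) {x y u t : ℝ} (hu : 0 ≤ u) (hur : u ≤ r)
    (ht : 0 ≤ t) (n : ℕ) (V : List ℕ) (hV : D.IsRowWord V) (hlow : κ * r ≤ t * D.height V)
    (hn : t * D.height V * ρ ^ n ≤ r) :
    SquareCover (affineBox x y u t '' D.strip V) r (κ⁻¹ ^ βy * (t * D.height V / r) ^ βy) := by
  have hbase : ∀ V, D.IsRowWord V → κ * r ≤ t * D.height V → t * D.height V ≤ r →
      SquareCover (affineBox x y u t '' D.strip V) r
        (κ⁻¹ ^ βy * (t * D.height V / r) ^ βy) := fun V hV hlow hle =>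
    (squareCover_strip_one hu hur ht hV hle).mono subset_rfl
      (one_le_inv_rpow_mul hB.κ_pos hβ hr hlow)
  induction n generalizing V with
  | zero => exact hbase V hV hlow (by simpa using hn)
  | succ n ih =>
    rcases le_or_gt (t * D.height V) r with hle | hlt
    · exact hbase V hV hlow hle
    have hth := mul_nonneg ht (height_pos hV).le
    have hstep : ∀ i ∈ Finset.range D.m,
        SquareCover (affineBox x y u t '' D.strip (V ++ [i])) r
          (κ⁻¹ ^ βy * (t * D.height V / r) ^ βy * D.b i ^ βy) := by
      intro i hi
      rw [Finset.mem_range] at hi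
      have hb := D.b_pos hi
      have := ih (V ++ [i]) (hV.append hi) (by
        rw [height_append, ← mul_assoc, mul_comm κ]
        exact mul_le_mul hlt.le (hB.κ_le_b hi) hB.κ_pos.le hth) (by
        rw [height_append, ← mul_assoc]
        refine le_trans ?_ hn
        rw [pow_succ', mul_assoc (t * D.height V)]
        have := hB.ρ_pos
        gcongr
        exact hB.le_ρ i hi)
      rwa [height_append, ← mul_assoc, mul_div_rpow hth hb.le hr, ← mul_assoc] at this
    refine (squareCover_of_subset_biUnion (Finset.range D.m)
      (E := affineBox x y u t '' D.strip V)
      (G := fun i => affineBox x y u t '' D.strip (V ++ [i])) ?_ hstep).mono subset_rfl ?_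
    · rintro _ ⟨p, hp, rfl⟩
      obtain ⟨i, hi, hpi⟩ := exists_mem_strip_append hp
      exact ⟨i, Finset.mem_range.2 hi, p, hpi, rfl⟩
    · rw [← Finset.mul_sum, hβy, mul_one]

theorem exists_mul_pow_le {ρ : ℝ} (h0 : 0 < ρ) (h1 : ρ < 1) (h : ℝ) {r : ℝ} (hr : 0 < r) :
    ∃ n : ℕ, h * ρ ^ n ≤ r := by
  obtain ⟨n, hn⟩ := exists_pow_lt_of_lt_one (show 0 < r / (|h| + 1) by positivity) h1
  refine ⟨n, ?_⟩
  rw [lt_div_iff₀ (by positivity)] at hn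
  have := le_abs_self h
  have := pow_pos h0 n
  nlinarith

/-- A copy of a strip which is at most as wide as its unrefined height is covered according to both
dimensions. -/
theorem squareCover_strip (hB : D.Bounds κ ρ) {βx βy r : ℝ} (hβx0 : 0 ≤ βx) (hβ : 0 ≤ βy)
    (hr : 0 < r) (hβy : ∑ i ∈ Finset.range D.m, D.b i ^ βy = 1)
    (hβx : ∀ i, i < D.m → ∑ j ∈ Finset.range (D.n i), D.a i j ^ βx ≤ 1)
    (n : ℕ) (V : List ℕ) (hV : D.IsRowWord V) (x y u t : ℝ) (hulow : κ * r ≤ u) (hut : u ≤ t)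
    (hlow : κ * r ≤ t * D.height V) (hn : u * ρ ^ n ≤ r) :
    SquareCover (affineBox x y u t '' D.strip V) r
      (κ⁻¹ ^ βx * κ⁻¹ ^ βy * (u / r) ^ βx * (t * D.height V / r) ^ βy) := by
  have hκ := hB.κ_pos
  have hρ := hB.ρ_pos
  have hbase : ∀ (V : List ℕ) (_ : D.IsRowWord V) (x y u t : ℝ) (_ : κ * r ≤ u) (_ : u ≤ t)
      (_ : κ * r ≤ t * D.height V) (_ : u ≤ r), SquareCover (affineBox x y u t '' D.strip V) r
        (κ⁻¹ ^ βx * κ⁻¹ ^ βy * (u / r) ^ βx * (t * D.height V / r) ^ βy) := by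
    intro V hV x y u t hulow hut hlow hur
    have hu : 0 ≤ u := by nlinarith
    obtain ⟨k, hk⟩ := exists_mul_pow_le hρ hB.ρ_lt (t * D.height V) hr
    refine (squareCover_strip_of_width_le hB hβ hr hβy hu hur (hu.trans hut) k V hV hlow hk).mono
      subset_rfl ?_
    have h1 := one_le_inv_rpow_mul hκ hβx0 hr hulow
    have h2 : 0 ≤ κ⁻¹ ^ βy * (t * D.height V / r) ^ βy :=
      mul_nonneg (by positivity)
        (Real.rpow_nonneg (div_nonneg ((mul_nonneg hκ.le hr.le).trans hlow) hr.le) _)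
    calc _ ≤ (κ⁻¹ ^ βx * (u / r) ^ βx) * (κ⁻¹ ^ βy * (t * D.height V / r) ^ βy) :=
          le_mul_of_one_le_left h2 h1
      _ = _ := by ring
  induction n generalizing V x y u t with
  | zero => exact hbase V hV x y u t hulow hut hlow (by simpa using hn)
  | succ n ih =>
    rcases le_or_gt u r with hle | hlt
    · exact hbase V hV x y u t hulow hut hlow hle
    have hu : 0 < u := hr.trans hlt
    have ht : 0 < t := hu.trans_le hut
    have hrow : ∀ (V : List ℕ) (_ : D.IsRowWord V) (i : ℕ) (_ : i < D.m)
        (_ : κ * r ≤ t * D.b i * D.height V),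
        SquareCover (affineBox x y u t '' D.strip (i :: V)) r
          (κ⁻¹ ^ βx * κ⁻¹ ^ βy * (u / r) ^ βx * (t * D.b i * D.height V / r) ^ βy) := by
      intro V hV i hi hlow
      have hb := D.b_pos hi
      have hh := height_pos hV
      refine (squareCover_of_subset_biUnion (Finset.range (D.n i))
        (G := fun j => affineBox (x + u * D.c i j) (y + t * D.d i) (u * D.a i j) (t * D.b i) ''
          D.strip V)
        (N := fun j => κ⁻¹ ^ βx * κ⁻¹ ^ βy * (u / r) ^ βx *
          (t * D.b i * D.height V / r) ^ βy * D.a i j ^ βx) ?_ ?_).mono subset_rfl ?_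
      · rintro _ ⟨_, ⟨j, hj, q, hq, rfl⟩, rfl⟩
        exact ⟨j, Finset.mem_range.2 hj, q, hq, (affineBox_lgMap x y u t i j q).symm⟩
      · intro j hj
        rw [Finset.mem_range] at hj
        have ha := D.ha_pos i hi j hj
        have := ih V hV (x + u * D.c i j) (y + t * D.d i) (u * D.a i j) (t * D.b i) (by
          rw [mul_comm κ]
          exact mul_le_mul hlt.le (hB.κ_le i hi j hj) hκ.le hu.le)
          (mul_le_mul hut (D.ha_lt_b i hi j hj).le ha.le ht.le) hlow (by
          refine le_trans ?_ hn
          rw [pow_succ', mul_assoc u]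
          gcongr
          exact hB.a_le_ρ hi hj)
        rw [mul_div_rpow hu.le ha.le hr] at this
        exact this.mono subset_rfl (le_of_eq (by ring))
      · rw [← Finset.mul_sum]
        exact mul_le_of_le_one_right (by positivity) (hβx i hi)
    cases V with
    | cons i V =>
      rw [isRowWord_cons] at hV
      have := hrow V hV.2 i hV.1 (by simpa only [height, mul_assoc] using hlow)
      simpa only [height, mul_assoc] using this
    | nil =>
      refine (squareCover_of_subset_biUnion (Finset.range D.m)
        (G := fun i => affineBox x y u t '' D.strip [i])
        (N := fun i => κ⁻¹ ^ βx * κ⁻¹ ^ βy * (u / r) ^ βx * (t / r) ^ βy * D.b i ^ βy)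
        ?_ ?_).mono subset_rfl ?_
      · rintro _ ⟨p, hp, rfl⟩
        obtain ⟨i, hi, hpi⟩ := exists_mem_strip_append hp
        exact ⟨i, Finset.mem_range.2 hi, p, hpi, rfl⟩
      · intro i hi
        rw [Finset.mem_range] at hi
        have := hrow [] IsRowWord.nil i hi (by
          rw [height, mul_one, mul_comm κ]
          exact mul_le_mul (hlt.le.trans hut) (hB.κ_le_b hi) hκ.le ht.le)
        rw [height, mul_one, mul_div_rpow ht.le (D.b_pos hi).le hr] at this
        exact this.mono subset_rfl (le_of_eq (by ring))
      · rw [← Finset.mul_sum, hβy, mul_one, height, mul_one]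

/-! ### The upper bound -/

/-- Covering the part of a copy of a strip of height comparable to `R` that lies over an interval of
radius `R`. -/
theorem squareCover_strip_window (hB : D.Bounds κ ρ) {βx βy r R : ℝ} (hβx0 : 0 ≤ βx)
    (hβ : 0 ≤ βy) (hr : 0 < r) (hrR : r ≤ R) (hβy : ∑ i ∈ Finset.range D.m, D.b i ^ βy = 1)
    (hβx : ∀ i, i < D.m → ∑ j ∈ Finset.range (D.n i), D.a i j ^ βx ≤ 1) (z : ℝ)
    (V : List ℕ) (hV : D.IsRowWord V) (x y u t : ℝ) (hulow : κ * R ≤ u) (hut : u ≤ t)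
    (hlow : κ * R ≤ t * D.height V) (hhigh : t * D.height V ≤ R) :
    SquareCover (affineBox x y u t '' D.strip V ∩ {p | |p.1 - z| ≤ R}) r
      (κ⁻¹ ^ βx * κ⁻¹ ^ βy * (R / r) ^ (βx + βy) * (κ * R)⁻¹ * clampLen z (2 * R) x u) := by
  have hκ := hB.κ_pos
  have hR : 0 < R := hr.trans_le hrR
  have hκR : 0 < κ * R := mul_pos hκ hR
  have hρ := hB.ρ_pos
  have hr' : κ * r ≤ κ * R := mul_le_mul_of_nonneg_left hrR hκ.le
  set K := κ⁻¹ ^ βx * κ⁻¹ ^ βy * (R / r) ^ (βx + βy) with hK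
  have hK0 : 0 ≤ K := by positivity
  have hbase : ∀ (V : List ℕ) (_ : D.IsRowWord V) (x y u t : ℝ) (_ : κ * R ≤ u) (_ : u ≤ t)
      (_ : κ * R ≤ t * D.height V) (_ : t * D.height V ≤ R) (_ : u ≤ R),
      SquareCover (affineBox x y u t '' D.strip V ∩ {p | |p.1 - z| ≤ R}) r
        (K * (κ * R)⁻¹ * clampLen z (2 * R) x u) := by
    intro V hV x y u t hulow hut hlow hhigh huR
    have hu : 0 < u := hκR.trans_le hulow
    have hth : 0 < t * D.height V := hκR.trans_le hlow
    rcases eq_empty_or_nonempty (affineBox x y u t '' D.strip V ∩ {p | |p.1 - z| ≤ R})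
      with hemp | ⟨_, ⟨p, hp, rfl⟩, hpz⟩
    · rw [hemp]
      exact squareCover_empty (mul_nonneg (mul_nonneg hK0 (inv_nonneg.2 hκR.le))
        (clampLen_nonneg _ _ _ hu.le))
    · rw [clampLen_eq_of_mem hu.le huR (strip_fst_mem hV hp) hpz]
      obtain ⟨k, hk⟩ := exists_mul_pow_le hρ hB.ρ_lt u hr
      refine (squareCover_strip hB hβx0 hβ hr hβy hβx k V hV x y u t (hr'.trans hulow) hut
        (hr'.trans hlow) hk).mono inter_subset_left ?_
      have h1 : 1 ≤ (κ * R)⁻¹ * u := by rwa [inv_mul_eq_div, one_le_div hκR]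
      calc _ ≤ κ⁻¹ ^ βx * κ⁻¹ ^ βy * (R / r) ^ βx * (R / r) ^ βy := by gcongr
        _ = K := by rw [hK, Real.rpow_add (div_pos hR hr)]; ring
        _ ≤ K * ((κ * R)⁻¹ * u) := le_mul_of_one_le_right hK0 h1
        _ = _ := by ring
  induction V generalizing x y u t with
  | nil =>
    exact hbase [] hV x y u t hulow hut hlow hhigh (hut.trans (by simpa [height] using hhigh))
  | cons i V ih =>
    rcases le_or_gt u R with hle | hlt
    · exact hbase (i :: V) hV x y u t hulow hut hlow hhigh hle
    rw [isRowWord_cons] at hV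
    obtain ⟨hi, hV⟩ := hV
    have hu : 0 < u := hR.trans hlt
    have ht : 0 < t := hu.trans_le hut
    refine (squareCover_of_subset_biUnion (Finset.range (D.n i))
      (G := fun j => affineBox (x + u * D.c i j) (y + t * D.d i) (u * D.a i j) (t * D.b i) ''
        D.strip V ∩ {p | |p.1 - z| ≤ R})
      (N := fun j => K * (κ * R)⁻¹ * clampLen z (2 * R) (x + u * D.c i j) (u * D.a i j))
      ?_ ?_).mono subset_rfl ?_
    · rintro _ ⟨⟨_, ⟨j, hj, q, hq, rfl⟩, rfl⟩, hz⟩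
      exact ⟨j, Finset.mem_range.2 hj, ⟨q, hq, (affineBox_lgMap x y u t i j q).symm⟩, hz⟩
    · intro j hj
      rw [Finset.mem_range] at hj
      have ha := D.ha_pos i hi j hj
      refine ih hV _ _ _ _ ?_ (mul_le_mul hut (D.ha_lt_b i hi j hj).le ha.le ht.le)
        (by simpa only [height, mul_assoc] using hlow)
        (by simpa only [height, mul_assoc] using hhigh)
      rw [mul_comm κ]
      exact mul_le_mul hlt.le (hB.κ_le i hi j hj) hκ.le hu.le
    · rw [← Finset.mul_sum]
      exact mul_le_mul_of_nonneg_left (D.sum_clampLen_column_le z (2 * R) x hu.le hi)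
        (mul_nonneg hK0 (inv_nonneg.2 hκR.le))

/-- Covering the part of a strip that lies in a square of half side `R`. -/
theorem squareCover_strip_square (hB : D.Bounds κ ρ) {βx βy r R : ℝ} (hβx0 : 0 ≤ βx)
    (hβ : 0 ≤ βy) (hr : 0 < r) (hrR : r ≤ R) (hR1 : R ≤ 1)
    (hβy : ∑ i ∈ Finset.range D.m, D.b i ^ βy = 1)
    (hβx : ∀ i, i < D.m → ∑ j ∈ Finset.range (D.n i), D.a i j ^ βx ≤ 1) (z : ℝ × ℝ)
    (n : ℕ) (V : List ℕ) (hV : D.IsRowWord V) (hlow : κ * R ≤ D.height V)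
    (hn : D.height V * ρ ^ n ≤ R) :
    SquareCover (D.strip V ∩ {p | |p.1 - z.1| ≤ R ∧ |p.2 - z.2| ≤ R}) r
      (κ⁻¹ ^ βx * κ⁻¹ ^ βy * (R / r) ^ (βx + βy) * (4 * κ⁻¹) * (κ * R)⁻¹ *
        clampLen z.2 (2 * R) (D.base V) (D.height V)) := by
  have hκ := hB.κ_pos
  have hρ := hB.ρ_pos
  have hR : 0 < R := hr.trans_le hrR
  have hκR : 0 < κ * R := mul_pos hκ hR
  set K := κ⁻¹ ^ βx * κ⁻¹ ^ βy * (R / r) ^ (βx + βy) with hK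
  have hK0 : 0 ≤ K := by positivity
  have hK1 : 0 ≤ K * (4 * κ⁻¹) * (κ * R)⁻¹ := by positivity
  have hbase : ∀ (V : List ℕ) (_ : D.IsRowWord V) (_ : κ * R ≤ D.height V)
      (_ : D.height V ≤ R), SquareCover (D.strip V ∩ {p | |p.1 - z.1| ≤ R ∧ |p.2 - z.2| ≤ R}) r
        (K * (4 * κ⁻¹) * (κ * R)⁻¹ * clampLen z.2 (2 * R) (D.base V) (D.height V)) := by
    intro V hV hlow hhigh
    have hh := height_pos hV
    rcases eq_empty_or_nonempty (D.strip V ∩ {p | |p.1 - z.1| ≤ R ∧ |p.2 - z.2| ≤ R})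
      with hemp | ⟨p, hp, -, hpz⟩
    · rw [hemp]
      exact squareCover_empty (mul_nonneg hK1 (clampLen_nonneg _ _ _ hh.le))
    · obtain ⟨s, hs, h2⟩ := exists_strip_snd_eq hp
      rw [h2] at hpz
      rw [clampLen_eq_of_mem hh.le hhigh hs hpz]
      have hcov := squareCover_strip_window hB hβx0 hβ hr hrR hβy hβx z.1 V hV 0 0 1 1
        (by nlinarith [hB.κ_le_one]) le_rfl (by simpa using hlow) (by simpa using hhigh)
      refine hcov.mono ?_ ?_
      · rintro q ⟨hq, hq1, -⟩
        exact ⟨⟨q, hq, by simp [affineBox]⟩, hq1⟩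
      · have h1 : 1 ≤ (κ * R)⁻¹ * D.height V := by rwa [inv_mul_eq_div, one_le_div hκR]
        have h3 := clampLen_le z.1 0 1 (show 0 ≤ 2 * R by positivity)
        calc _ ≤ K * (κ * R)⁻¹ * (2 * (2 * R)) := by gcongr
          _ = K * (4 * κ⁻¹) := by field_simp; ring
          _ ≤ K * (4 * κ⁻¹) * ((κ * R)⁻¹ * D.height V) :=
            le_mul_of_one_le_right (by positivity) h1
          _ = _ := by ring
  induction n generalizing V with
  | zero => exact hbase V hV hlow (by simpa using hn)
  | succ n ih =>
    rcases le_or_gt (D.height V) R with hle | hlt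
    · exact hbase V hV hlow hle
    have hh := height_pos hV
    refine (squareCover_of_subset_biUnion (Finset.range D.m)
      (G := fun i => D.strip (V ++ [i]) ∩ {p | |p.1 - z.1| ≤ R ∧ |p.2 - z.2| ≤ R})
      (N := fun i => K * (4 * κ⁻¹) * (κ * R)⁻¹ *
        clampLen z.2 (2 * R) (D.base V + D.height V * D.d i) (D.height V * D.b i))
      ?_ ?_).mono subset_rfl ?_
    · rintro p ⟨hp, hz⟩
      obtain ⟨i, hi, hpi⟩ := exists_mem_strip_append hp
      exact ⟨i, Finset.mem_range.2 hi, hpi, hz⟩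
    · intro i hi
      rw [Finset.mem_range] at hi
      have hb := D.b_pos hi
      rw [← height_append, ← base_append]
      refine ih (V ++ [i]) (hV.append hi) ?_ ?_
      · rw [height_append, mul_comm κ]
        exact mul_le_mul hlt.le (hB.κ_le_b hi) hκ.le hh.le
      · rw [height_append]
        refine le_trans ?_ hn
        rw [pow_succ', mul_assoc (D.height V)]
        gcongr
        exact hB.le_ρ i hi
    · rw [← Finset.mul_sum]
      exact mul_le_mul_of_nonneg_left (D.sum_clampLen_row_le z.2 (2 * R) _ hh.le) hK1

theorem exists_squareCover_limitSet {βx βy : ℝ} (hβx0 : 0 ≤ βx) (hβ : 0 ≤ βy)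
    (hβy : ∑ i ∈ Finset.range D.m, D.b i ^ βy = 1)
    (hβx : ∀ i, i < D.m → ∑ j ∈ Finset.range (D.n i), D.a i j ^ βx ≤ 1) :
    ∃ C : ℝ, 0 < C ∧ ∀ (z : ℝ × ℝ) (r R : ℝ), 0 < r → r ≤ R → R ≤ 1 →
      SquareCover (D.limitSet ∩ {p | |p.1 - z.1| ≤ R ∧ |p.2 - z.2| ≤ R}) r
        (C * (R / r) ^ (βx + βy)) := by
  obtain ⟨κ, ρ, hB⟩ := D.exists_bounds
  have hκ := hB.κ_pos
  refine ⟨κ⁻¹ ^ βx * κ⁻¹ ^ βy * (4 * κ⁻¹) * (4 * κ⁻¹), by positivity, ?_⟩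
  intro z r R hr hrR hR1
  have hR : 0 < R := hr.trans_le hrR
  obtain ⟨n, hn⟩ := exists_mul_pow_le hB.ρ_pos hB.ρ_lt (D.height []) hR
  refine (squareCover_strip_square hB hβx0 hβ hr hrR hR1 hβy hβx z n [] IsRowWord.nil
    (by rw [height]; nlinarith [hB.κ_le_one]) hn).mono subset_rfl ?_
  have h3 := clampLen_le z.2 (D.base []) (D.height []) (show 0 ≤ 2 * R by positivity)
  calc _ ≤ κ⁻¹ ^ βx * κ⁻¹ ^ βy * (R / r) ^ (βx + βy) * (4 * κ⁻¹) * (κ * R)⁻¹ *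
        (2 * (2 * R)) := by gcongr
    _ = _ := by field_simp; ring

/-! ### The lower bound -/

/-- The finset `F` of centres of squares of half side `r` covers `E`. -/
def Covers (F : Finset (ℝ × ℝ)) (r : ℝ) (E : Set (ℝ × ℝ)) : Prop :=
  ∀ p ∈ E, ∃ q ∈ F, |p.1 - q.1| ≤ r ∧ |p.2 - q.2| ≤ r

/-- The total area, counted with multiplicity, of the parts of the rectangle
`[x, x + u] × [y, y + h]` lying in the squares of half side `2r` centred at the points of `F`. -/
def coverArea (F : Finset (ℝ × ℝ)) (r x u y h : ℝ) : ℝ :=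
  ∑ q ∈ F, clampLen q.1 (2 * r) x u * clampLen q.2 (2 * r) y h

theorem coverArea_le (F : Finset (ℝ × ℝ)) {r x u y h : ℝ} (hr : 0 ≤ r) (hh : 0 ≤ h) :
    coverArea F r x u y h ≤ F.card * (16 * r ^ 2) := by
  unfold coverArea
  rw [← nsmul_eq_mul]
  refine Finset.sum_le_card_nsmul _ _ _ fun q _ => ?_
  have h1 := clampLen_le q.1 x u (show 0 ≤ 2 * r by positivity)
  have h2 := clampLen_le q.2 y h (show 0 ≤ 2 * r by positivity)
  calc _ ≤ 2 * (2 * r) * (2 * (2 * r)) :=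
        mul_le_mul h1 h2 (clampLen_nonneg _ _ _ hh) (by positivity)
    _ = _ := by ring

theorem sum_coverArea_row_le (F : Finset (ℝ × ℝ)) (r x y : ℝ) {u h : ℝ} (hu : 0 ≤ u)
    (hh : 0 ≤ h) :
    ∑ i ∈ Finset.range D.m, coverArea F r x u (y + h * D.d i) (h * D.b i) ≤
      coverArea F r x u y h := by
  unfold coverArea
  rw [Finset.sum_comm]
  refine Finset.sum_le_sum fun q _ => ?_
  rw [← Finset.mul_sum]
  exact mul_le_mul_of_nonneg_left (D.sum_clampLen_row_le _ _ _ hh) (clampLen_nonneg _ _ _ hu)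

theorem sum_coverArea_column_le (F : Finset (ℝ × ℝ)) (r x y : ℝ) {u h : ℝ} (hu : 0 ≤ u)
    (hh : 0 ≤ h) {i : ℕ} (hi : i < D.m) :
    ∑ j ∈ Finset.range (D.n i), coverArea F r (x + u * D.c i j) (u * D.a i j) y h ≤
      coverArea F r x u y h := by
  unfold coverArea
  rw [Finset.sum_comm]
  refine Finset.sum_le_sum fun q _ => ?_
  rw [← Finset.sum_mul]
  exact mul_le_mul_of_nonneg_right (D.sum_clampLen_column_le _ _ _ hu hi)
    (clampLen_nonneg _ _ _ hh)

/-- A covering of a nonempty piece of size at most `r` charges the whole rectangle. -/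
theorem mul_le_coverArea {F : Finset (ℝ × ℝ)} {r x y u t : ℝ} {V : List ℕ}
    (hV : D.IsRowWord V) (hu : 0 ≤ u) (hur : u ≤ r) (ht : 0 ≤ t) (hle : t * D.height V ≤ r)
    (hF : Covers F r (affineBox x y u t '' D.strip V)) :
    u * (t * D.height V) ≤ coverArea F r x u (y + t * D.base V) (t * D.height V) := by
  have hth := mul_nonneg ht (height_pos hV).le
  obtain ⟨p, hp⟩ := strip_nonempty hV
  obtain ⟨q, hq, hq1, hq2⟩ := hF _ ⟨p, hp, rfl⟩
  obtain ⟨s, hs, h2⟩ := exists_strip_snd_eq hp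
  have e1 := clampLen_eq_of_mem hu hur (strip_fst_mem hV hp) hq1
  have e2 := clampLen_eq_of_mem (c := q.2) (x := y + t * D.base V) hth hle hs (by
    refine le_trans (le_of_eq ?_) hq2
    simp only [affineBox, h2]
    ring_nf)
  calc u * (t * D.height V) = clampLen q.1 (2 * r) x u *
        clampLen q.2 (2 * r) (y + t * D.base V) (t * D.height V) := by rw [e1, e2]
    _ ≤ _ := Finset.single_le_sum (f := fun q : ℝ × ℝ => clampLen q.1 (2 * r) x u *
        clampLen q.2 (2 * r) (y + t * D.base V) (t * D.height V))
        (fun q _ => mul_nonneg (clampLen_nonneg _ _ _ hu) (clampLen_nonneg _ _ _ hth)) hq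

/-- Coverings of copies of strips of width comparable to `r`. -/
theorem le_coverArea_of_width_le (hB : D.Bounds κ ρ) {βy r : ℝ} (hβ : 0 ≤ βy) (hr : 0 < r)
    (hβy : ∑ i ∈ Finset.range D.m, D.b i ^ βy = 1) {F : Finset (ℝ × ℝ)} {x y u t : ℝ}
    (hulow : κ * r ≤ u) (hur : u ≤ r) (ht : 0 ≤ t) (n : ℕ) (V : List ℕ) (hV : D.IsRowWord V)
    (hlow : κ * r ≤ t * D.height V) (hn : t * D.height V * ρ ^ n ≤ r)
    (hF : Covers F r (affineBox x y u t '' D.strip V)) :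
    (κ * r) ^ 2 * (t * D.height V / r) ^ βy ≤
      coverArea F r x u (y + t * D.base V) (t * D.height V) := by
  have hκ := hB.κ_pos
  have hρ := hB.ρ_pos
  have hκr : 0 < κ * r := mul_pos hκ hr
  have hu : 0 ≤ u := hκr.le.trans hulow
  have hbase : ∀ (V : List ℕ) (_ : D.IsRowWord V) (_ : κ * r ≤ t * D.height V)
      (_ : t * D.height V ≤ r) (_ : Covers F r (affineBox x y u t '' D.strip V)),
      (κ * r) ^ 2 * (t * D.height V / r) ^ βy ≤
        coverArea F r x u (y + t * D.base V) (t * D.height V) := by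
    intro V hV hlow hle hF
    refine le_trans ?_ (mul_le_coverArea hV hu hur ht hle hF)
    have h0 : 0 ≤ t * D.height V := hκr.le.trans hlow
    have h1 : (t * D.height V / r) ^ βy ≤ 1 :=
      Real.rpow_le_one (div_nonneg h0 hr.le) ((div_le_one hr).2 hle) hβ
    calc _ ≤ (κ * r) ^ 2 := mul_le_of_le_one_right (by positivity) h1
      _ = κ * r * (κ * r) := by ring
      _ ≤ _ := mul_le_mul hulow hlow hκr.le hu
  induction n generalizing V with
  | zero => exact hbase V hV hlow (by simpa using hn) hF
  | succ n ih =>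
    rcases le_or_gt (t * D.height V) r with hle | hlt
    · exact hbase V hV hlow hle hF
    have hth := mul_nonneg ht (height_pos hV).le
    refine le_trans ?_ (sum_coverArea_row_le (D := D) F r x _ hu hth)
    calc (κ * r) ^ 2 * (t * D.height V / r) ^ βy
        = ∑ i ∈ Finset.range D.m, (κ * r) ^ 2 * (t * D.height V / r) ^ βy * D.b i ^ βy := by
          rw [← Finset.mul_sum, hβy, mul_one]
      _ ≤ _ := Finset.sum_le_sum fun i hi => ?_
    rw [Finset.mem_range] at hi
    have hb := D.b_pos hi
    have := ih (V ++ [i]) (hV.append hi) (by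
      rw [height_append, ← mul_assoc, mul_comm κ]
      exact mul_le_mul hlt.le (hB.κ_le_b hi) hκ.le hth) (by
      rw [height_append, ← mul_assoc]
      refine le_trans ?_ hn
      rw [pow_succ', mul_assoc (t * D.height V)]
      gcongr
      exact hB.le_ρ i hi) (by
      rintro _ ⟨p, hp, rfl⟩
      exact hF _ ⟨p, strip_append_subset V hi hp, rfl⟩)
    rw [height_append, base_append, ← mul_assoc t, mul_div_rpow hth hb.le hr, ← mul_assoc,
      mul_add, ← mul_assoc t, ← add_assoc] at this
    exact this

/-- Coverings of copies of strips along a constant row word. -/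
theorem le_coverArea_replicate (hB : D.Bounds κ ρ) {βx βy r : ℝ} (hβx0 : 0 ≤ βx) (hβ : 0 ≤ βy)
    (hr : 0 < r) (hβy : ∑ i ∈ Finset.range D.m, D.b i ^ βy = 1) {i : ℕ} (hi : i < D.m)
    (hβx : ∑ j ∈ Finset.range (D.n i), D.a i j ^ βx = 1) {F : Finset (ℝ × ℝ)} (L : ℕ)
    (x y u t : ℝ) (hulow : κ * r ≤ u) (ht : 0 ≤ t) (hlow : κ * r ≤ t * D.b i ^ L)
    (hL : u * ρ ^ L ≤ r)
    (hF : Covers F r (affineBox x y u t '' D.strip (List.replicate L i))) :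
    (κ * r) ^ 2 * (u / r) ^ βx * (t * D.b i ^ L / r) ^ βy ≤
      coverArea F r x u (y + t * D.base (List.replicate L i)) (t * D.b i ^ L) := by
  have hκ := hB.κ_pos
  have hρ := hB.ρ_pos
  have hκr : 0 < κ * r := mul_pos hκ hr
  have hb := D.b_pos hi
  have hbase : ∀ (L : ℕ) (x y u t : ℝ) (_ : κ * r ≤ u) (_ : 0 ≤ t)
      (_ : κ * r ≤ t * D.b i ^ L) (_ : u ≤ r)
      (_ : Covers F r (affineBox x y u t '' D.strip (List.replicate L i))),
      (κ * r) ^ 2 * (u / r) ^ βx * (t * D.b i ^ L / r) ^ βy ≤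
        coverArea F r x u (y + t * D.base (List.replicate L i)) (t * D.b i ^ L) := by
    intro L x y u t hulow ht hlow hur hF
    have hu : 0 ≤ u := hκr.le.trans hulow
    rw [← height_replicate] at hlow ⊢
    obtain ⟨k, hk⟩ := exists_mul_pow_le hρ hB.ρ_lt (t * D.height (List.replicate L i)) hr
    refine le_trans ?_ (le_coverArea_of_width_le hB hβ hr hβy hulow hur ht k _
      (isRowWord_replicate hi L) hlow hk hF)
    have h1 : (u / r) ^ βx ≤ 1 :=
      Real.rpow_le_one (div_nonneg hu hr.le) ((div_le_one hr).2 hur) hβx0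
    have h2 : 0 ≤ (t * D.height (List.replicate L i) / r) ^ βy :=
      Real.rpow_nonneg (div_nonneg (hκr.le.trans hlow) hr.le) _
    exact mul_le_mul_of_nonneg_right (mul_le_of_le_one_right (by positivity) h1) h2
  induction L generalizing x y u t with
  | zero => exact hbase 0 x y u t hulow ht hlow (by simpa using hL) hF
  | succ L ih =>
    rcases le_or_gt u r with hle | hlt
    · exact hbase (L + 1) x y u t hulow ht hlow hle hF
    have hu : 0 < u := hr.trans hlt
    have hth : 0 ≤ t * D.b i ^ (L + 1) := hκr.le.trans hlow
    have hpow : t * D.b i ^ (L + 1) = t * D.b i * D.b i ^ L := by ring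
    refine le_trans ?_ (sum_coverArea_column_le F r x _ hu.le hth hi)
    calc (κ * r) ^ 2 * (u / r) ^ βx * (t * D.b i ^ (L + 1) / r) ^ βy
        = ∑ j ∈ Finset.range (D.n i), (κ * r) ^ 2 * (u / r) ^ βx *
            (t * D.b i ^ (L + 1) / r) ^ βy * D.a i j ^ βx := by
          rw [← Finset.mul_sum, hβx, mul_one]
      _ ≤ _ := Finset.sum_le_sum fun j hj => ?_
    rw [Finset.mem_range] at hj
    have ha := D.ha_pos i hi j hj
    have := ih (x + u * D.c i j) (y + t * D.d i) (u * D.a i j) (t * D.b i) (by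
      rw [mul_comm κ]
      exact mul_le_mul hlt.le (hB.κ_le i hi j hj) hκ.le hu.le) (mul_nonneg ht hb.le)
      (by rwa [← hpow]) (by
      refine le_trans ?_ hL
      rw [pow_succ', mul_assoc u]
      gcongr
      exact hB.a_le_ρ hi hj) (by
      rintro _ ⟨p, hp, rfl⟩
      refine hF _ ⟨lgMap D (i, j) p, ⟨j, hj, p, hp, rfl⟩, affineBox_lgMap x y u t i j p⟩)
    rw [mul_div_rpow hu.le ha.le hr, ← hpow] at this
    rw [List.replicate_succ, base]
    refine le_trans (le_of_eq (by ring)) (this.trans (le_of_eq ?_))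
    congr 1
    ring

theorem exists_affineBox_mapsTo {i j : ℕ} (hi : i < D.m) (hj : j < D.n i) (k : ℕ) :
    ∃ x y : ℝ, ∀ q ∈ D.limitSet, affineBox x y (D.a i j ^ k) (D.b i ^ k) q ∈ D.limitSet := by
  induction k with
  | zero => exact ⟨0, 0, fun q hq => by simpa [affineBox] using hq⟩
  | succ k ih =>
    obtain ⟨x, y, h⟩ := ih
    refine ⟨x + D.a i j ^ k * D.c i j, y + D.b i ^ k * D.d i, fun q hq => ?_⟩
    have := h _ (D.lgMap_mem_limitSet hi hj hq)
    rwa [affineBox_lgMap, ← pow_succ, ← pow_succ] at this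

/-- A power of `a` is followed, up to the factor `b`, by a product `b ^ k * b ^ L` with `L` as large
as desired. -/
theorem exists_pow_mul_pow_le {a b : ℝ} (ha : 0 < a) (hab : a < b) (hb : b < 1) (L₀ : ℕ) :
    ∃ k L : ℕ, L₀ ≤ L ∧ b ^ k * b ^ L ≤ a ^ k ∧ b * a ^ k ≤ b ^ k * b ^ L := by
  have hb0 : 0 < b := ha.trans hab
  obtain ⟨k, hk⟩ := exists_pow_lt_of_lt_one (pow_pos hb0 L₀) ((div_lt_one hb0).2 hab)
  rw [div_pow, div_lt_iff₀ (pow_pos hb0 k)] at hk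
  have hex : ∃ L : ℕ, b ^ k * b ^ L ≤ a ^ k :=
    exists_mul_pow_le hb0 hb (b ^ k) (pow_pos ha k)
  classical
  have hspec := Nat.find_spec hex
  have hlt : L₀ < Nat.find hex := by
    by_contra! hle
    have h1 : b ^ L₀ ≤ b ^ Nat.find hex := pow_le_pow_of_le_one hb0.le hb.le hle
    have h2 := mul_le_mul_of_nonneg_left h1 (pow_pos hb0 k).le
    linarith
  obtain ⟨M, hM⟩ : ∃ M, Nat.find hex = M + 1 := ⟨Nat.find hex - 1, by omega⟩
  have hmin := Nat.find_min hex (m := M) (by omega)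
  push Not at hmin
  refine ⟨k, Nat.find hex, hlt.le, hspec, ?_⟩
  rw [hM, pow_succ]
  nlinarith

/-- At every relative scale `δ` there is a small piece of the carpet which is as hard to cover as a
product of dimension `βx + βy`. -/
theorem exists_piece_le_card {βx βy : ℝ} (hβx0 : 0 ≤ βx) (hβ : 0 ≤ βy)
    (hβy : ∑ i ∈ Finset.range D.m, D.b i ^ βy = 1)
    (hβx : ∃ i, i < D.m ∧ ∑ j ∈ Finset.range (D.n i), D.a i j ^ βx = 1) :
    ∃ c : ℝ, 0 < c ∧ ∀ δ : ℝ, 0 < δ → δ ≤ 1 → ∃ u : ℝ, 0 < u ∧ ∃ E ⊆ D.limitSet, E.Nonempty ∧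
      (∀ p ∈ E, ∀ q ∈ E, |p.1 - q.1| ≤ u ∧ |p.2 - q.2| ≤ u) ∧
      ∀ F : Finset (ℝ × ℝ), Covers F (δ * u) E → c * δ⁻¹ ^ (βx + βy) ≤ F.card := by
  obtain ⟨κ, ρ, hB⟩ := D.exists_bounds
  obtain ⟨i, hi, hβx⟩ := hβx
  have hκ := hB.κ_pos
  have hκ1 := hB.κ_le_one
  refine ⟨κ ^ 2 * κ ^ βy / 16, by positivity, fun δ hδ hδ1 => ?_⟩
  have hj : 0 < D.n i := D.hn_one i hi
  have ha := D.ha_pos i hi 0 hj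
  have hb := D.b_pos hi
  obtain ⟨L₀, hL₀⟩ := exists_pow_lt_of_lt_one hδ hB.ρ_lt
  obtain ⟨k, L, hL, hle, hge⟩ :=
    exists_pow_mul_pow_le ha (D.ha_lt_b i hi 0 hj) (D.hb_lt_one i hi) L₀
  obtain ⟨x, y, hxy⟩ := exists_affineBox_mapsTo hi hj k
  set u := D.a i 0 ^ k with hu_def
  set t := D.b i ^ k with ht_def
  have hu : 0 < u := pow_pos ha k
  have ht : 0 < t := pow_pos hb k
  have hV := isRowWord_replicate hi L
  have hκu : κ * u ≤ t * D.b i ^ L :=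
    (mul_le_mul_of_nonneg_right (hB.κ_le_b hi) hu.le).trans hge
  refine ⟨u, hu, affineBox x y u t '' D.strip (List.replicate L i), ?_,
    (strip_nonempty hV).image _, ?_, ?_⟩
  · rintro _ ⟨p, hp, rfl⟩
    exact hxy p (strip_subset_limitSet hV hp)
  · rintro _ ⟨p, hp, rfl⟩ _ ⟨q, hq, rfl⟩
    have hp1 := strip_fst_mem hV hp
    have hq1 := strip_fst_mem hV hq
    obtain ⟨s, hs, hp2⟩ := exists_strip_snd_eq hp
    obtain ⟨s', hs', hq2⟩ := exists_strip_snd_eq hq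
    rw [height_replicate] at hp2 hq2
    have hth : 0 ≤ t * D.b i ^ L := by positivity
    constructor
    · rw [show (affineBox x y u t p).1 - (affineBox x y u t q).1 = u * (p.1 - q.1) by
        simp only [affineBox]; ring, abs_mul, abs_of_pos hu]
      refine mul_le_of_le_one_right hu.le (abs_le.2 ⟨?_, ?_⟩) <;>
        linarith [hp1.1, hp1.2, hq1.1, hq1.2]
    · rw [show (affineBox x y u t p).2 - (affineBox x y u t q).2 =
        t * D.b i ^ L * (s - s') by simp only [affineBox, hp2, hq2]; ring, abs_mul,
        abs_of_nonneg hth]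
      refine (mul_le_of_le_one_right hth (abs_le.2 ⟨?_, ?_⟩)).trans hle <;>
        linarith [hs.1, hs.2, hs'.1, hs'.2]
  · intro F hF
    have hr : 0 < δ * u := mul_pos hδ hu
    have hru : δ * u ≤ u := mul_le_of_le_one_left hu.le hδ1
    have hκr : κ * (δ * u) ≤ κ * u := mul_le_mul_of_nonneg_left hru hκ.le
    have hmain := le_coverArea_replicate hB hβx0 hβ hr hβy hi hβx L x y u t
      (hκr.trans (mul_le_of_le_one_left hu.le hκ1)) ht.le (hκr.trans hκu) (by
        rw [mul_comm δ]
        refine mul_le_mul_of_nonneg_left ?_ hu.le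
        exact (pow_le_pow_of_le_one hB.ρ_pos.le hB.ρ_lt.le hL).trans hL₀.le) hF
    have hcard := hmain.trans (coverArea_le F hr.le (by positivity))
    have h1 : (κ * δ⁻¹) ^ βy ≤ (t * D.b i ^ L / (δ * u)) ^ βy := by
      refine Real.rpow_le_rpow (by positivity) ?_ hβ
      rw [le_div_iff₀ hr]
      calc κ * δ⁻¹ * (δ * u) = κ * u := by field_simp
        _ ≤ _ := hκu
    have h2 : u / (δ * u) = δ⁻¹ := by field_simp
    rw [h2] at hcard
    have h3 : (κ * (δ * u)) ^ 2 * δ⁻¹ ^ βx * (κ * δ⁻¹) ^ βy ≤ F.card * (16 * (δ * u) ^ 2) :=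
      (mul_le_mul_of_nonneg_left h1 (by positivity)).trans hcard
    rw [Real.mul_rpow hκ.le (inv_nonneg.2 hδ.le)] at h3
    rw [Real.rpow_add (inv_pos.2 hδ)]
    refine le_of_mul_le_mul_right ?_ (show 0 < 16 * (δ * u) ^ 2 by positivity)
    refine le_trans (le_of_eq ?_) h3
    ring

end LGData

/-! ### Comparison with the Euclidean metric -/

theorem abs_sub_apply_le_dist (x y : EuclideanSpace ℝ (Fin 2)) (i : Fin 2) :
    |x i - y i| ≤ dist x y := by
  rw [EuclideanSpace.dist_eq, ← Real.dist_eq]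
  refine Real.le_sqrt_of_sq_le ?_
  exact Finset.single_le_sum (f := fun i => dist (x i) (y i) ^ 2) (fun _ _ => sq_nonneg _)
    (Finset.mem_univ i)

theorem dist_lt_two_mul {x y : EuclideanSpace ℝ (Fin 2)} {s : ℝ} (hs : 0 < s)
    (h0 : |x 0 - y 0| ≤ s) (h1 : |x 1 - y 1| ≤ s) : dist x y < 2 * s := by
  rw [EuclideanSpace.dist_eq, Real.sqrt_lt' (by positivity), Fin.sum_univ_two, Real.dist_eq,
    Real.dist_eq]
  have := pow_le_pow_left₀ (abs_nonneg _) h0 2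
  have := pow_le_pow_left₀ (abs_nonneg _) h1 2
  nlinarith

theorem toE_apply_zero (p : ℝ × ℝ) : toE p 0 = p.1 := by simp [toE]

theorem toE_apply_one (p : ℝ × ℝ) : toE p 1 = p.2 := by simp [toE]

theorem LGData.exists_cover_lgCarpet (D : LGData) {βx βy : ℝ} (hβx0 : 0 ≤ βx) (hβ : 0 ≤ βy)
    (hβy : ∑ i ∈ Finset.range D.m, D.b i ^ βy = 1)
    (hβx : ∀ i, i < D.m → ∑ j ∈ Finset.range (D.n i), D.a i j ^ βx ≤ 1) :
    ∃ C : ℝ, 0 < C ∧ ∀ x ∈ lgCarpet D, ∀ r R : ℝ, 0 < r → r ≤ R →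
      ∃ F : Finset (EuclideanSpace ℝ (Fin 2)), (F.card : ℝ) ≤ C * (R / r) ^ (βx + βy) ∧
        lgCarpet D ∩ ball x R ⊆ ⋃ y ∈ F, ball y r := by
  classical
  obtain ⟨C, hC, hcov⟩ := LGData.exists_squareCover_limitSet hβx0 hβ hβy hβx
  refine ⟨C * 2 ^ (βx + βy), by positivity, fun x hx r R hr hrR => ?_⟩
  have hR : 0 < R := hr.trans_le hrR
  have hr2 : 0 < min (r / 2) 1 := lt_min (by positivity) one_pos
  obtain ⟨F, hF, hFc⟩ := hcov (x 0, x 1) (min (r / 2) 1) (min R 1) hr2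
    (min_le_min_right 1 (by linarith)) (min_le_right _ _)
  refine ⟨F.image toE, ?_, ?_⟩
  · calc ((F.image toE).card : ℝ) ≤ F.card := by exact_mod_cast Finset.card_image_le
      _ ≤ C * (min R 1 / min (r / 2) 1) ^ (βx + βy) := hF
      _ ≤ C * (2 * (R / r)) ^ (βx + βy) := by
        have : min R 1 / min (r / 2) 1 ≤ 2 * (R / r) := by
          rw [div_le_iff₀ hr2]
          rcases le_total (r / 2) 1 with h | h
          · rw [min_eq_left h]
            refine (min_le_left _ _).trans (le_of_eq ?_)
            field_simp
          · rw [min_eq_right h, mul_one]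
            refine (min_le_right _ _).trans ?_
            have := (one_le_div hr).2 hrR
            linarith
        have : 0 < min R 1 := lt_min hR one_pos
        gcongr
      _ = _ := by rw [Real.mul_rpow (by norm_num) (by positivity)]; ring
  · rintro z ⟨hz, hzx⟩
    rw [D.mem_lgCarpet_iff] at hz hx
    have hz' := D.limitSet_subset_unit hz
    have hx' := D.limitSet_subset_unit hx
    obtain ⟨⟨h1, h2⟩, h3, h4⟩ := hz'
    obtain ⟨⟨h5, h6⟩, h7, h8⟩ := hx'
    rw [mem_ball] at hzx
    obtain ⟨q, hq, hq0, hq1⟩ := hFc (z 0, z 1) ⟨hz,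
      le_min ((abs_sub_apply_le_dist z x 0).trans hzx.le)
        (abs_le.2 ⟨by dsimp only at *; linarith, by dsimp only at *; linarith⟩),
      le_min ((abs_sub_apply_le_dist z x 1).trans hzx.le)
        (abs_le.2 ⟨by dsimp only at *; linarith, by dsimp only at *; linarith⟩)⟩
    simp only [mem_iUnion]
    refine ⟨toE q, Finset.mem_image_of_mem _ hq, ?_⟩
    rw [mem_ball]
    have := dist_lt_two_mul (x := z) (y := toE q) hr2 (by rwa [toE_apply_zero])
      (by rwa [toE_apply_one])
    have := min_le_left (r / 2) 1
    linarith

theorem LGData.le_of_cover_lgCarpet (D : LGData) {βx βy : ℝ} (hβx0 : 0 ≤ βx) (hβ : 0 ≤ βy)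
    (hβy : ∑ i ∈ Finset.range D.m, D.b i ^ βy = 1)
    (hβx : ∃ i, i < D.m ∧ ∑ j ∈ Finset.range (D.n i), D.a i j ^ βx = 1) {α C : ℝ} (hC : 0 < C)
    (hcov : ∀ x ∈ lgCarpet D, ∀ r R : ℝ, 0 < r → r ≤ R →
      ∃ F : Finset (EuclideanSpace ℝ (Fin 2)), (F.card : ℝ) ≤ C * (R / r) ^ α ∧
        lgCarpet D ∩ ball x R ⊆ ⋃ y ∈ F, ball y r) : βx + βy ≤ α := by
  classical
  obtain ⟨c, hc, hpiece⟩ := LGData.exists_piece_le_card hβx0 hβ hβy hβx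
  have key : ∀ δ : ℝ, 0 < δ → δ ≤ 1 → c * δ⁻¹ ^ (βx + βy) ≤ C * (2 * δ⁻¹) ^ α := by
    intro δ hδ hδ1
    obtain ⟨u, hu, E, hE, ⟨p, hp⟩, hdiam, hcard⟩ := hpiece δ hδ hδ1
    have hmem : ∀ q ∈ E, toE q ∈ lgCarpet D := fun q hq => by
      rw [D.mem_lgCarpet_iff, toE_apply_zero, toE_apply_one]
      exact hE hq
    obtain ⟨F, hF, hFc⟩ := hcov (toE p) (hmem p hp) (δ * u) (2 * u) (by positivity) (by nlinarith)
    rw [show 2 * u / (δ * u) = 2 * δ⁻¹ by field_simp] at hF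
    refine le_trans (hcard (F.image fun x => (x 0, x 1)) ?_)
      (le_trans (by exact_mod_cast Finset.card_image_le) hF)
    intro q hq
    have hq' : toE q ∈ lgCarpet D ∩ ball (toE p) (2 * u) := by
      refine ⟨hmem q hq, ?_⟩
      have := hdiam q hq p hp
      exact dist_lt_two_mul hu (by simpa only [toE_apply_zero] using this.1)
        (by simpa only [toE_apply_one] using this.2)
    have := hFc hq'
    simp only [mem_iUnion, mem_ball] at this
    obtain ⟨x, hx, hqx⟩ := this
    refine ⟨_, Finset.mem_image_of_mem _ hx, ?_, ?_⟩
    · have := (abs_sub_apply_le_dist (toE q) x 0).trans hqx.le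
      rwa [toE_apply_zero] at this
    · have := (abs_sub_apply_le_dist (toE q) x 1).trans hqx.le
      rwa [toE_apply_one] at this
  by_contra! hlt
  set ε := βx + βy - α with hε
  have hε0 : 0 < ε := by linarith
  set M := C * 2 ^ α / c + 1 with hM
  have hM1 : 1 ≤ M := by
    have : 0 ≤ C * 2 ^ α / c := by positivity
    linarith
  have hT1 : 1 ≤ M ^ ε⁻¹ := Real.one_le_rpow hM1 (inv_nonneg.2 hε0.le)
  have hT0 : 0 < M ^ ε⁻¹ := one_pos.trans_le hT1
  have h := key (M ^ ε⁻¹)⁻¹ (inv_pos.2 hT0) (inv_le_one_of_one_le₀ hT1)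
  rw [inv_inv, Real.mul_rpow (by norm_num) hT0.le, show βx + βy = ε + α by rw [hε]; ring,
    Real.rpow_add hT0, ← Real.rpow_mul (by linarith), inv_mul_cancel₀ hε0.ne', Real.rpow_one,
    ← mul_assoc, ← mul_assoc] at h
  have h' := le_of_mul_le_mul_right h (Real.rpow_pos_of_pos hT0 α)
  have : c * M = C * 2 ^ α + c := by rw [hM]; field_simp
  linarith

/-- The Assouad dimension of a Lalley–Gatzouras carpet equals `β_x + β_y`,
where `β_y ∈ (0,1]` solves `Σ_i b_i^{β_y} = 1` and `β_x ∈ (0,1]` is the largest solution of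
`Σ_j a_{ij}^{β_x} = 1` over the rows `i`. -/
theorem lg_assouadDim_eq (D : LGData)

    (βx βy : ℝ)
    (hβy_mem : βy ∈ Set.Ioc (0 : ℝ) 1)
    (hβy_eq : ∑ i ∈ Finset.range D.m, D.b i ^ βy = 1)
    (hβx_mem : βx ∈ Set.Ioc (0 : ℝ) 1)
    (hβx_eq : ∃ i, i < D.m ∧ ∑ j ∈ Finset.range (D.n i), D.a i j ^ βx = 1)
    (hβx_max : ∀ α ∈ Set.Ioc (0 : ℝ) 1,
      (∃ i, i < D.m ∧ ∑ j ∈ Finset.range (D.n i), D.a i j ^ α = 1) → α ≤ βx) :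
    assouadDim (lgCarpet D) = βx + βy := by
  have hsum := fun i hi => LGData.sum_a_rpow_le_one hβx_mem hβx_max (i := i) hi
  have hmem : βx + βy ∈ { α : ℝ | 0 ≤ α ∧ ∃ C : ℝ, 0 < C ∧ ∀ x ∈ lgCarpet D, ∀ r R : ℝ,
      0 < r → r ≤ R → ∃ F : Finset (EuclideanSpace ℝ (Fin 2)),
        (F.card : ℝ) ≤ C * (R / r) ^ α ∧ lgCarpet D ∩ ball x R ⊆ ⋃ y ∈ F, ball y r } :=
    ⟨add_nonneg hβx_mem.1.le hβy_mem.1.le,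
      D.exists_cover_lgCarpet hβx_mem.1.le hβy_mem.1.le hβy_eq hsum⟩
  refine le_antisymm (csInf_le ⟨0, fun α hα => hα.1⟩ hmem) (le_csInf ⟨_, hmem⟩ ?_)
  rintro α ⟨-, C, hC, hcov⟩
  exact D.le_of_cover_lgCarpet hβx_mem.1.le hβy_mem.1.le hβy_eq hβx_eq hC hcov
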